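/- Let X be a variable and e1, e2, f1, f2 expressions. If ν X = e1 ≡ ν X = f1 and ν X = e2 ≡ ν X = f2, then ν X = e1 ∨ e2 ≡ ν X = f1 ∨ f2. -/

import Mathlib

namespace RESpaper

noncomputable section

/-- Addition on the extended reals in which `⊤` (i.e. `∞`) dominates. -/
def eadd (x y : EReal) : EReal := if x = ⊤ ∨ y = ⊤ then ⊤ else x + y

/-- The operator `eq-∞`. -/
def eqNegInfVal (x : EReal) : EReal := if x = ⊥ then ⊥ else ⊤

/-- The operator `eq∞`. -/
def eqInfVal (x : EReal) : EReal := if x = ⊤ then ⊤ else ⊥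

open Classical in
/-- The sum, with respect to `eadd`, of a finite family of extended reals. -/
def eSum {ι : Type*} (s : Finset ι) (e : ι → EReal) : EReal :=
  if ∃ i ∈ s, e i = ⊤ then ⊤ else ∑ i ∈ s, e i

/-- Syntax of expressions over a set `V` of variables. -/
inductive Expr (V : Type*) where
  | var : V → Expr V
  | const : EReal → Expr V
  | scale : {c : ℝ // 0 < c} → Expr V → Expr V
  | add : Expr V → Expr V → Expr V
  | emin : Expr V → Expr V → Expr V
  | emax : Expr V → Expr V → Expr V
  | condL : Expr V → Expr V → Expr V → Expr V   -- (e₁ ⇒ e₂ ◇ e₃)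
  | condR : Expr V → Expr V → Expr V → Expr V   -- (e₁ → e₂ ◇ e₃)
  | eqm : Expr V → Expr V                       -- eq-∞(e)

variable {V : Type*}

/-- Evaluation of an expression under a valuation `η`. -/
def Expr.eval (η : V → EReal) : Expr V → EReal
  | var X => η X
  | const d => d
  | scale c e => (c.1 : EReal) * Expr.eval η e
  | add e₁ e₂ => eadd (Expr.eval η e₁) (Expr.eval η e₂)
  | emin e₁ e₂ => Expr.eval η e₁ ⊓ Expr.eval η e₂
  | emax e₁ e₂ => Expr.eval η e₁ ⊔ Expr.eval η e₂
  | condL e₁ e₂ e₃ =>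
      if Expr.eval η e₁ ≤ 0 then Expr.eval η e₂ ⊓ Expr.eval η e₃ else Expr.eval η e₃
  | condR e₁ e₂ e₃ =>
      if Expr.eval η e₁ < 0 then Expr.eval η e₂ else Expr.eval η e₂ ⊔ Expr.eval η e₃
  | eqm e => eqNegInfVal (Expr.eval η e)

/-- The set of variables occurring in an expression. -/
def Expr.occ : Expr V → Set V
  | var X => {X}
  | const _ => ∅
  | scale _ e => Expr.occ e
  | add e₁ e₂ => Expr.occ e₁ ∪ Expr.occ e₂
  | emin e₁ e₂ => Expr.occ e₁ ∪ Expr.occ e₂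
  | emax e₁ e₂ => Expr.occ e₁ ∪ Expr.occ e₂
  | condL e₁ e₂ e₃ => Expr.occ e₁ ∪ Expr.occ e₂ ∪ Expr.occ e₃
  | condR e₁ e₂ e₃ => Expr.occ e₁ ∪ Expr.occ e₂ ∪ Expr.occ e₃
  | eqm e => Expr.occ e

/-- `e` contains no occurrence of the conditional operators. -/
def Expr.noCond : Expr V → Prop
  | var _ => True
  | const _ => True
  | scale _ e => Expr.noCond e
  | add e₁ e₂ => Expr.noCond e₁ ∧ Expr.noCond e₂
  | emin e₁ e₂ => Expr.noCond e₁ ∧ Expr.noCond e₂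
  | emax e₁ e₂ => Expr.noCond e₁ ∧ Expr.noCond e₂
  | condL _ _ _ => False
  | condR _ _ _ => False
  | eqm e => Expr.noCond e

/-- Syntactic substitution `e[X := g]`. -/
def Expr.subst [DecidableEq V] (X : V) (g : Expr V) : Expr V → Expr V
  | var Y => if Y = X then g else var Y
  | const d => const d
  | scale c e => scale c (Expr.subst X g e)
  | add e₁ e₂ => add (Expr.subst X g e₁) (Expr.subst X g e₂)
  | emin e₁ e₂ => emin (Expr.subst X g e₁) (Expr.subst X g e₂)
  | emax e₁ e₂ => emax (Expr.subst X g e₁) (Expr.subst X g e₂)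
  | condL e₁ e₂ e₃ => condL (Expr.subst X g e₁) (Expr.subst X g e₂) (Expr.subst X g e₃)
  | condR e₁ e₂ e₃ => condR (Expr.subst X g e₁) (Expr.subst X g e₂) (Expr.subst X g e₃)
  | eqm e => eqm (Expr.subst X g e)

/-- `(Σ_{(c,X) ∈ cs} c·X) + rest`. -/
def scaledSum (cs : List ({c : ℝ // 0 < c} × V)) (rest : Expr V) : Expr V :=
  cs.foldr (fun p acc => Expr.add (Expr.scale p.1 (Expr.var p.2)) acc) rest

/-- `(Σ_{X ∈ ms} eq-∞(X)) + rest`. -/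
def eqmSum (ms : List V) (rest : Expr V) : Expr V :=
  ms.foldr (fun X acc => Expr.add (Expr.eqm (Expr.var X)) acc) rest

/-- A term of the shape `(Σ_{X∈𝒳'} c^X·X) + (Σ_{X∈𝒳''} eq-∞(X)) + d`
with the variables in each of the two sums pairwise distinct. -/
def IsSimpleTerm (e : Expr V) : Prop :=
  ∃ (cs : List ({c : ℝ // 0 < c} × V)) (ms : List V) (d : EReal),
    (cs.map Prod.snd).Nodup ∧ ms.Nodup ∧ e = scaledSum cs (eqmSum ms (Expr.const d))

/-- Finite disjunction; the empty disjunction is `−∞`. -/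
def disjList : List (Expr V) → Expr V
  | [] => Expr.const ⊥
  | [e] => e
  | e :: es => Expr.emax e (disjList es)

/-- Finite conjunction; the empty conjunction is `∞`. -/
def conjList : List (Expr V) → Expr V
  | [] => Expr.const ⊤
  | [e] => e
  | e :: es => Expr.emin e (conjList es)

/-- Simple conjunctive normal form. -/
def IsSimpleCNF (e : Expr V) : Prop :=
  ∃ ls : List (List (Expr V)),
    (∀ l ∈ ls, ∀ t ∈ l, IsSimpleTerm t) ∧ e = conjList (ls.map disjList)

/-- Simple disjunctive normal form. -/
def IsSimpleDNF (e : Expr V) : Prop :=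
  ∃ ls : List (List (Expr V)),
    (∀ l ∈ ls, ∀ t ∈ l, IsSimpleTerm t) ∧ e = disjList (ls.map conjList)

/-- Conjunctive normal form. -/
inductive IsCNF : Expr V → Prop where
  | simple {e : Expr V} : IsSimpleCNF e → IsCNF e
  | condL {e₁ e₂ e₃ : Expr V} :
      IsSimpleCNF e₁ → IsCNF e₂ → IsCNF e₃ → IsCNF (Expr.condL e₁ e₂ e₃)
  | condR {e₁ e₂ e₃ : Expr V} :
      IsSimpleCNF e₁ → IsCNF e₂ → IsCNF e₃ → IsCNF (Expr.condR e₁ e₂ e₃)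

/-- Disjunctive normal form. -/
inductive IsDNF : Expr V → Prop where
  | simple {e : Expr V} : IsSimpleDNF e → IsDNF e
  | condL {e₁ e₂ e₃ : Expr V} :
      IsSimpleDNF e₁ → IsDNF e₂ → IsDNF e₃ → IsDNF (Expr.condL e₁ e₂ e₃)
  | condR {e₁ e₂ e₃ : Expr V} :
      IsSimpleDNF e₁ → IsDNF e₂ → IsDNF e₃ → IsDNF (Expr.condR e₁ e₂ e₃)

/-- Fixed-point symbols. -/
inductive FP where
  | mu : FP
  | nu : FP

/-- A real equation system: a finite sequence of fixed-point equations `σ X = e`. -/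
abbrev RES (V : Type*) := List (FP × V × Expr V)

/-- The bound variables of a RES. -/
def bnd (E : RES V) : List V := E.map (fun p => p.2.1)

variable [DecidableEq V]

/-- The solution `[[ℰ]]η` of a real equation system. -/
def sol : RES V → (V → EReal) → V → EReal
  | [], η => η
  | (FP.mu, X, e) :: E, η =>
      sol E (Function.update η X
        (sInf {r : EReal | Expr.eval (sol E (Function.update η X r)) e ≤ r}))
  | (FP.nu, X, e) :: E, η =>
      sol E (Function.update η X
        (sSup {r : EReal | r ≤ Expr.eval (sol E (Function.update η X r)) e}))

/-- Equivalence of real equation systems. -/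
def REquiv (E E' : RES V) : Prop :=
  ∀ F : RES V, (∀ Y ∈ bnd F, Y ∉ bnd E ∧ Y ∉ bnd E') →
    ∀ η : V → EReal, sol (E ++ F) η = sol (E' ++ F) η


/-- A solution agrees with the given valuation on unbound variables. -/
theorem sol_apply_of_notMem_bnd (X : V) (F : RES V) (hX : X ∉ bnd F) (η : V → EReal) :
    sol F η X = η X := by
  induction F generalizing η with
  | nil => rfl
  | cons p F ih =>
    obtain ⟨σ, Y, e⟩ := p
    simp only [bnd, List.map_cons, List.mem_cons, not_or] at hX
    cases σ <;> simp only [sol] <;> rw [ih hX.2, Function.update_of_ne hX.1]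

/-- Equivalent single maximal fixed-point equations have the same greatest fixed points. -/
theorem REquiv.sSup_eq {X : V} {e f : Expr V} (h : REquiv [(FP.nu, X, e)] [(FP.nu, X, f)])
    {F : RES V} (hX : X ∉ bnd F) (η : V → EReal) :
    sSup {r : EReal | r ≤ Expr.eval (sol F (Function.update η X r)) e} =
      sSup {r : EReal | r ≤ Expr.eval (sol F (Function.update η X r)) f} := by
  have hF : ∀ Y ∈ bnd F, Y ∉ bnd [(FP.nu, X, e)] ∧ Y ∉ bnd [(FP.nu, X, f)] := by
    intro Y hY
    have hne : Y ≠ X := fun hYX => hX (hYX ▸ hY)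
    simp [bnd, hne]
  have hsol := congrFun (h F hF η) X
  simpa only [List.singleton_append, sol, sol_apply_of_notMem_bnd X F hX,
    Function.update_self] using hsol

/-- The greatest fixed point of a maximum is the maximum of the greatest fixed points. -/
theorem sSup_le_eval_emax (X : V) (e₁ e₂ : Expr V) (F : RES V) (η : V → EReal) :
    sSup {r : EReal | r ≤ Expr.eval (sol F (Function.update η X r)) (Expr.emax e₁ e₂)} =
      sSup {r : EReal | r ≤ Expr.eval (sol F (Function.update η X r)) e₁} ⊔
        sSup {r : EReal | r ≤ Expr.eval (sol F (Function.update η X r)) e₂} := by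
  simp only [Expr.eval, le_sup_iff, Set.ofPred_or, sSup_union]

/-- property E7: maximal fixed points and disjunction. -/
theorem equiv_max_nu (X : V) (e₁ e₂ f₁ f₂ : Expr V)
    (h1 : REquiv [(FP.nu, X, e₁)] [(FP.nu, X, f₁)])
    (h2 : REquiv [(FP.nu, X, e₂)] [(FP.nu, X, f₂)]) :
    REquiv [(FP.nu, X, Expr.emax e₁ e₂)] [(FP.nu, X, Expr.emax f₁ f₂)] := by
  intro F hF η
  have hX : X ∉ bnd F := fun hX => (hF X hX).1 (by simp [bnd])
  simp only [List.singleton_append, sol, sSup_le_eval_emax, h1.sSup_eq hX, h2.sSup_eq hX]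

end
end RESpaper
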